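/- Suppose Φ is irreducible and not of type G₂. Let Ψ ⊆ Φ⁺ be any subset such that 𝔞_Ψ = ⊕_{α∈Ψ} 𝔤_α is a spherical subspace of 𝔫, i.e. ad(x)⁴ = 0 for every x ∈ 𝔞_Ψ. Then ⟨α,β⟩ ≥ 0 for all α, β ∈ Ψ. -/

import Mathlib

/- Background setup: a finite reduced crystallographic root system `Φ` with chosen
positive roots `Φ⁺` in a euclidean space `V`, the Cartan pairing, and the basic
combinatorial notions used in the statement. -/

open scoped RealInnerProductSpace

noncomputable section

variable {V : Type*} [NormedAddCommGroup V] [InnerProductSpace ℝ V]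

/-- The Cartan pairing `⟨α, β⟩ = 2 (α, β) / (β, β)`. -/
def cpair (α β : V) : ℝ := 2 * ⟪α, β⟫ / ⟪β, β⟫

/-- The reflection associated to `β`, as a linear endomorphism of `V`:
`v ↦ v - (2 (β, v)/(β, β)) • β`. -/
def reflEnd (β : V) : Module.End ℝ V :=
  LinearMap.id -
    (LinearMap.toSpanSingleton ℝ V β ∘ₗ ((2 / ⟪β, β⟫) • (innerSL ℝ β).toLinearMap))

/-- A subset of `V` is orthogonal if the Cartan pairing of any two distinct
elements vanishes. -/
def OrthogonalSet (S : Set V) : Prop := ∀ γ ∈ S, ∀ γ' ∈ S, γ ≠ γ' → cpair γ γ' = 0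

/-- A finite reduced crystallographic root system in the euclidean space `V`,
together with a choice of positive roots. -/
structure RootSystemData (V : Type*) [NormedAddCommGroup V] [InnerProductSpace ℝ V] where
  /-- the set of roots Φ -/
  roots : Set V
  /-- the set of positive roots Φ⁺ -/
  pos : Set V
  finite : roots.Finite
  ne_zero : ∀ α ∈ roots, α ≠ 0
  span_eq_top : Submodule.span ℝ roots = ⊤
  reduced : ∀ α ∈ roots, ∀ t : ℝ, t • α ∈ roots → t = 1 ∨ t = -1
  crystallographic : ∀ α ∈ roots, ∀ β ∈ roots, ∃ n : ℤ, cpair α β = (n : ℝ)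
  reflect_mem : ∀ α ∈ roots, ∀ β ∈ roots, reflEnd β α ∈ roots
  pos_subset : pos ⊆ roots
  pos_iff : ∀ α ∈ roots, (α ∈ pos ↔ ¬ (-α ∈ pos))
  pos_add : ∀ α ∈ pos, ∀ β ∈ pos, α + β ∈ roots → α + β ∈ pos

namespace RootSystemData

variable (D : RootSystemData V)

/-- Irreducibility: the roots admit no nontrivial partition into two mutually
orthogonal parts. -/
def IsIrreducible : Prop :=
  D.roots.Nonempty ∧
    ∀ s ⊆ D.roots, (∀ α ∈ s, ∀ β ∈ D.roots \ s, ⟪α, β⟫ = 0) → s = ∅ ∨ s = D.roots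

/-- An irreducible root system is not of type `G₂` iff no Cartan pairing of two
roots equals `±3`. -/
def NotG2 : Prop := ∀ α ∈ D.roots, ∀ β ∈ D.roots, cpair α β ≠ 3 ∧ cpair α β ≠ -3

/-- An irreducible root system is of type `G₂` iff some Cartan pairing of two
roots equals `±3`. -/
def IsG2 : Prop :=
  D.IsIrreducible ∧ ∃ α ∈ D.roots, ∃ β ∈ D.roots, cpair α β = 3 ∨ cpair α β = -3

/-- All roots have the same length (types A, D, E). -/
def SimplyLaced : Prop := ∀ α ∈ D.roots, ∀ β ∈ D.roots, ⟪α, α⟫ = ⟪β, β⟫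

/-- There are exactly two root lengths, with squared-length ratio 2
(types B, C, F₄). -/
def DoublyLaced : Prop :=
  (∃ α ∈ D.roots, ∃ β ∈ D.roots, ⟪β, β⟫ = 2 * ⟪α, α⟫) ∧
    ∀ α ∈ D.roots, ∀ β ∈ D.roots,
      ⟪α, α⟫ = ⟪β, β⟫ ∨ ⟪β, β⟫ = 2 * ⟪α, α⟫ ∨ ⟪α, α⟫ = 2 * ⟪β, β⟫

/-- A root of maximal length. -/
def IsLong (α : V) : Prop := α ∈ D.roots ∧ ∀ β ∈ D.roots, ⟪β, β⟫ ≤ ⟪α, α⟫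

/-- A root of minimal length. -/
def IsShort (α : V) : Prop := α ∈ D.roots ∧ ∀ β ∈ D.roots, ⟪α, α⟫ ≤ ⟪β, β⟫

/-- A set of positive roots is convex if any root which is a linear combination of
two of its elements with positive coefficients lies in it. -/
def ConvexSubset (S : Set V) : Prop :=
  ∀ α ∈ S, ∀ β ∈ S, ∀ a b : ℝ, 0 < a → 0 < b →
    a • α + b • β ∈ D.roots → a • α + b • β ∈ S

/-- A subset `Ψ ⊆ Φ⁺` is biconvex if both `Ψ` and `Φ⁺ \ Ψ` are convex. -/
def Biconvex (S : Set V) : Prop :=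
  S ⊆ D.pos ∧ D.ConvexSubset S ∧ D.ConvexSubset (D.pos \ S)

/-- A subset `Ψ ⊆ Φ⁺` is a combinatorial ideal if `α ∈ Ψ`, `β ∈ Φ⁺`, `α + β ∈ Φ⁺`
imply `α + β ∈ Ψ`. -/
def CombIdeal (S : Set V) : Prop :=
  S ⊆ D.pos ∧ ∀ α ∈ S, ∀ β ∈ D.pos, α + β ∈ D.pos → α + β ∈ S

end RootSystemData

/- The Lie-theoretic setup: a finite-dimensional complex simple Lie algebra `𝔤`
with Cartan subalgebra `𝔱`, whose root space decomposition is indexed by the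
root system `Φ ⊆ V`. -/

/-- A finite-dimensional simple complex Lie algebra `L`, together with a Cartan
subalgebra and its root space decomposition, whose root system is `Φ ⊆ V` with a
choice of positive roots (determining the Borel subalgebra `𝔟 = 𝔱 ⊕ 𝔫`). -/
structure LieRootData (V : Type*) [NormedAddCommGroup V] [InnerProductSpace ℝ V]
    (L : Type*) [LieRing L] [LieAlgebra ℂ L] extends RootSystemData V where
  /-- the Cartan subalgebra 𝔱 -/
  cartan : LieSubalgebra ℂ L
  /-- the root space 𝔤_α attached to each root α -/
  rs : V → Submodule ℂ L
  finiteDim : FiniteDimensional ℂ L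
  isSimple : LieAlgebra.IsSimple ℂ L
  isCartan : cartan.IsCartanSubalgebra
  rs_dim : ∀ α ∈ roots, Module.finrank ℂ (rs α) = 1
  sup_eq_top : cartan.toSubmodule ⊔ (⨆ α ∈ roots, rs α) = ⊤
  indep : ∀ α ∈ roots, rs α ⊓ (cartan.toSubmodule ⊔ ⨆ β ∈ roots \ {α}, rs β) = ⊥
  weight_vec : ∀ α ∈ roots, ∀ h ∈ cartan, ∀ x ∈ rs α, ∃ c : ℂ, ⁅h, x⁆ = c • x
  bracket_mem : ∀ α ∈ roots, ∀ β ∈ roots, α + β ∈ roots →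
    ∀ x ∈ rs α, ∀ y ∈ rs β, ⁅x, y⁆ ∈ rs (α + β)
  bracket_ne_zero : ∀ α ∈ roots, ∀ β ∈ roots, α + β ∈ roots →
    ∀ x ∈ rs α, x ≠ 0 → ∀ y ∈ rs β, y ≠ 0 → ⁅x, y⁆ ≠ 0
  bracket_eq_zero : ∀ α ∈ roots, ∀ β ∈ roots, α + β ∉ roots → α + β ≠ 0 →
    ∀ x ∈ rs α, ∀ y ∈ rs β, ⁅x, y⁆ = 0
  bracket_cartan_mem : ∀ α ∈ roots, ∀ x ∈ rs α, ∀ y ∈ rs (-α), ⁅x, y⁆ ∈ cartan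

namespace LieRootData

variable {L : Type*} [LieRing L] [LieAlgebra ℂ L] (D : LieRootData V L)

/-- The nilradical `𝔫 = ⊕_{α ∈ Φ⁺} 𝔤_α` of the Borel subalgebra, as a submodule. -/
def nilrad : Submodule ℂ L := ⨆ α ∈ D.pos, D.rs α

/-- The Borel subalgebra `𝔟 = 𝔱 ⊕ 𝔫`, as a submodule. -/
def borel : Submodule ℂ L := D.cartan.toSubmodule ⊔ D.nilrad

/-- The subspace `𝔞_Ψ = ⊕_{α ∈ Ψ} 𝔤_α` attached to a subset `Ψ ⊆ Φ⁺`. -/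
def aSubspace (S : Set V) : Submodule ℂ L := ⨆ α ∈ S, D.rs α

end LieRootData

/-- A subspace of `𝔫` is spherical if `ad(x)^4 = 0` for every `x` in it. -/
def IsSphericalSubspace {L : Type*} [LieRing L] [LieAlgebra ℂ L]
    (a : Submodule ℂ L) : Prop :=
  ∀ x ∈ a, (LieAlgebra.ad ℂ L x) ^ 4 = 0

/-- The height of a nilpotent element `x`: `max {n | ad(x)^n ≠ 0}`. -/
noncomputable def heightOf {L : Type*} [LieRing L] [LieAlgebra ℂ L] (x : L) : ℕ :=
  sSup {n : ℕ | (LieAlgebra.ad ℂ L x) ^ n ≠ 0}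

section Helpers

variable {L : Type*} [LieRing L] [LieAlgebra ℂ L]

/-- Rank two computation of type `A₂`. -/
theorem helper_A2 (a b f : L) (A₁ B₁ A₂ B₂ : ℂ)
    (hp : ⁅a, ⁅a, f⁆⁆ = 0) (hq : ⁅b, ⁅b, f⁆⁆ = 0)
    (ha : a ≠ 0) (hb : b ≠ 0) (hc : ⁅a, b⁆ ≠ 0)
    (hac : ⁅a, ⁅a, b⁆⁆ = 0) (hbc : ⁅b, ⁅a, b⁆⁆ = 0)
    (h1a : ⁅⁅b, ⁅a, f⁆⁆, a⁆ = A₁ • a) (h1b : ⁅⁅b, ⁅a, f⁆⁆, b⁆ = B₁ • b)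
    (h2a : ⁅⁅a, ⁅b, f⁆⁆, a⁆ = A₂ • a) (h2b : ⁅⁅a, ⁅b, f⁆⁆, b⁆ = B₂ • b)
    (hpc : ⁅⁅a, f⁆, ⁅a, b⁆⁆ ≠ 0)
    (h4 : (LieAlgebra.ad ℂ L (a + b)) ^ 4 = 0) : False := by
  obtain ⟨p, hpdef⟩ : ∃ p, p = ⁅a, f⁆ := ⟨_, rfl⟩
  obtain ⟨q, hqdef⟩ : ∃ q, q = ⁅b, f⁆ := ⟨_, rfl⟩
  obtain ⟨c, hcdef⟩ : ∃ c, c = ⁅a, b⁆ := ⟨_, rfl⟩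
  obtain ⟨H, hH⟩ : ∃ H, H = ⁅b, p⁆ := ⟨_, rfl⟩
  obtain ⟨K, hK⟩ : ∃ K, K = ⁅a, q⁆ := ⟨_, rfl⟩
  rw [← hpdef] at hp h1a h1b hpc
  rw [← hqdef] at hq h2a h2b
  rw [← hcdef] at hc hac hbc hpc
  rw [← hH] at h1a h1b
  rw [← hK] at h2a h2b
  have hba : ⁅b, a⁆ = -c := by rw [hcdef, lie_skew]
  have hpa : ⁅p, a⁆ = 0 := by rw [← lie_skew, hp, neg_zero]
  have hpb : ⁅p, b⁆ = -H := by rw [hH, lie_skew]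
  have hqa : ⁅q, a⁆ = -K := by rw [hK, lie_skew]
  have hqb : ⁅q, b⁆ = 0 := by rw [← lie_skew, hq, neg_zero]
  have hfa : ⁅f, a⁆ = -p := by rw [hpdef, lie_skew]
  have hfb : ⁅f, b⁆ = -q := by rw [hqdef, lie_skew]
  have haH : ⁅a, H⁆ = -(A₁ • a) := by rw [← h1a, lie_skew]
  have hbH : ⁅b, H⁆ = -(B₁ • b) := by rw [← h1b, lie_skew]
  have haK : ⁅a, K⁆ = -(A₂ • a) := by rw [← h2a, lie_skew]
  have hbK : ⁅b, K⁆ = -(B₂ • b) := by rw [← h2b, lie_skew]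
  have epc : ⁅p, c⁆ = A₁ • a := by
    rw [hcdef, leibniz_lie, hpa, hpb, lie_neg, haH]; simp
  have eqc : ⁅q, c⁆ = -(B₂ • b) := by
    rw [hcdef, leibniz_lie, hqa, hqb, neg_lie, h2b]; simp
  have hA₁ : A₁ ≠ 0 := by rintro rfl; exact hpc (by rw [epc, zero_smul])
  have eHc : ⁅H, c⁆ = (A₁ + B₁) • c := by
    rw [hcdef, leibniz_lie, h1a, h1b, smul_lie, lie_smul, add_smul]
  have eKc : ⁅K, c⁆ = (A₂ + B₂) • c := by
    rw [hcdef, leibniz_lie, h2a, h2b, smul_lie, lie_smul, add_smul]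
  have r1 : B₁ = -2 * A₁ := by
    have h : ⁅p, ⁅b, c⁆⁆ = 0 := by rw [hbc, lie_zero]
    rw [leibniz_lie, hpb, epc, neg_lie, eHc, lie_smul, hba] at h
    have : (-(2 * A₁ + B₁)) • c = 0 := by rw [← h]; module
    rcases smul_eq_zero.1 this with h | h
    · linear_combination -h
    · exact absurd h hc
  have r2 : A₂ = -2 * B₂ := by
    have h : ⁅q, ⁅a, c⁆⁆ = 0 := by rw [hac, lie_zero]
    rw [leibniz_lie, hqa, eqc, neg_lie, eKc, lie_neg, lie_smul, ← hcdef] at h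
    have : (-(A₂ + 2 * B₂)) • c = 0 := by rw [← h]; module
    rcases smul_eq_zero.1 this with h | h
    · linear_combination -h
    · exact absurd h hc
  have efc : ⁅f, c⁆ = H - K := by
    rw [hcdef, leibniz_lie, hfa, hfb, neg_lie, hpb, lie_neg, ← hK]; abel
  have r3 : A₂ = 2 * A₁ := by
    have h : ⁅f, ⁅c, a⁆⁆ = 0 := by rw [← lie_skew c a, hac, neg_zero, lie_zero]
    rw [leibniz_lie, efc, hfa, sub_lie, h1a, h2a, lie_neg, lie_skew, epc] at h
    have : (2 * A₁ - A₂) • a = 0 := by rw [← h]; module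
    rcases smul_eq_zero.1 this with h | h
    · linear_combination -h
    · exact absurd h ha
  have e4 : ((LieAlgebra.ad ℂ L (a + b)) ^ 4) f = (A₁ + A₂ - B₁ - B₂) • c := by
    have e1 : ⁅a + b, f⁆ = p + q := by rw [add_lie, hpdef, hqdef]
    have e2 : ⁅a + b, p + q⁆ = H + K := by
      rw [add_lie, lie_add, lie_add, hp, hq, ← hH, ← hK]; abel
    have e3 : ⁅a + b, H + K⁆ = -((A₁ + A₂) • a) - (B₁ + B₂) • b := by
      rw [add_lie, lie_add, lie_add, haH, haK, hbH, hbK]; module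
    have e5 : ⁅a + b, -((A₁ + A₂) • a) - (B₁ + B₂) • b⁆ = (A₁ + A₂ - B₁ - B₂) • c := by
      rw [add_lie, lie_sub, lie_sub, lie_neg, lie_neg, lie_smul, lie_smul, lie_smul, lie_smul,
        lie_self, lie_self, hba, ← hcdef]; module
    simp only [pow_succ, pow_zero, one_mul, Module.End.mul_apply, LieAlgebra.ad_apply]
    rw [e1, e2, e3, e5]
  rw [h4, LinearMap.zero_apply] at e4
  rcases smul_eq_zero.1 e4.symm with h | h
  · apply hA₁
    linear_combination (1 / 6) * h + (1 / 6) * r1 + (1 / 12) * r2 - (1 / 4) * r3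
  · exact hc h

/-- Rank two computation of type `B₂`. -/
theorem helper_B2 (a b f : L) (A B : ℂ)
    (hbf : ⁅b, f⁆ = 0) (hu2 : ⁅a, ⁅a, b⁆⁆ ≠ 0) (hu3 : ⁅a, ⁅a, ⁅a, b⁆⁆⁆ = 0)
    (hbu : ⁅b, ⁅a, b⁆⁆ = 0)
    (hHa : ⁅⁅a, f⁆, a⁆ = A • a) (hHb : ⁅⁅a, f⁆, b⁆ = B • b)
    (hfu : ⁅f, ⁅a, b⁆⁆ ≠ 0)
    (h4 : (LieAlgebra.ad ℂ L (a + b)) ^ 4 = 0) : False := by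
  obtain ⟨H, hH⟩ : ∃ H, H = ⁅a, f⁆ := ⟨_, rfl⟩
  obtain ⟨u, hu⟩ : ∃ u, u = ⁅a, b⁆ := ⟨_, rfl⟩
  obtain ⟨w, hw⟩ : ∃ w, w = ⁅a, u⁆ := ⟨_, rfl⟩
  rw [← hH] at hHa hHb
  rw [← hu] at hu2 hu3 hbu hfu
  rw [← hw] at hu2 hu3
  have hba : ⁅b, a⁆ = -u := by rw [hu, lie_skew]
  have hfa : ⁅f, a⁆ = -H := by rw [hH, lie_skew]
  have hfb : ⁅f, b⁆ = 0 := by rw [← lie_skew, hbf, neg_zero]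
  have haH : ⁅a, H⁆ = -(A • a) := by rw [← hHa, lie_skew]
  have hbH : ⁅b, H⁆ = -(B • b) := by rw [← hHb, lie_skew]
  have eHu : ⁅H, u⁆ = (A + B) • u := by
    rw [hu, leibniz_lie, hHa, hHb, smul_lie, lie_smul, add_smul]
  have eHw : ⁅H, w⁆ = (2 * A + B) • w := by
    rw [hw, leibniz_lie, hHa, eHu, smul_lie, lie_smul]; module
  have efu : ⁅f, u⁆ = -(B • b) := by
    rw [hu, leibniz_lie, hfa, hfb, neg_lie, hHb]; simp
  have hB : B ≠ 0 := by rintro rfl; exact hfu (by rw [efu, zero_smul, neg_zero])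
  have efw : ⁅f, w⁆ = -((A + 2 * B) • u) := by
    rw [hw, leibniz_lie, hfa, efu, neg_lie, eHu, lie_neg, lie_smul, ← hu]; module
  have r : A = -B := by
    have h : ⁅f, ⁅a, w⁆⁆ = 0 := by rw [hu3, lie_zero]
    rw [leibniz_lie, hfa, efw, neg_lie, eHw, lie_neg, lie_smul, ← hw] at h
    have : (-(3 * (A + B))) • w = 0 := by rw [← h]; module
    rcases smul_eq_zero.1 this with h | h
    · linear_combination -(1 / 3) * h
    · exact absurd h hu2
  have e4 : ((LieAlgebra.ad ℂ L (a + b)) ^ 4) f = (A - B) • w := by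
    have e1 : ⁅a + b, f⁆ = H := by rw [add_lie, hbf, add_zero, hH]
    have e2 : ⁅a + b, H⁆ = -(A • a) - B • b := by
      rw [add_lie, haH, hbH]; module
    have e3 : ⁅a + b, -(A • a) - B • b⁆ = (A - B) • u := by
      rw [add_lie, lie_sub, lie_sub, lie_neg, lie_neg, lie_smul, lie_smul, lie_smul, lie_smul,
        lie_self, lie_self, hba, ← hu]; module
    have e5 : ⁅a + b, (A - B) • u⁆ = (A - B) • w := by
      rw [add_lie, lie_smul, lie_smul, hbu, ← hw, smul_zero, add_zero]
    simp only [pow_succ, pow_zero, one_mul, Module.End.mul_apply, LieAlgebra.ad_apply]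
    rw [e1, e2, e3, e5]
  rw [h4, LinearMap.zero_apply] at e4
  rcases smul_eq_zero.1 e4.symm with h | h
  · apply hB
    linear_combination -(1 / 2) * h + (1 / 2) * r
  · exact hu2 h

theorem helper_exists (D : LieRootData V L) {α : V} (hα : α ∈ D.roots) :
    ∃ x ∈ D.rs α, x ≠ 0 := by
  have h := D.rs_dim α hα
  have : D.rs α ≠ ⊥ := by
    intro h0
    rw [h0, finrank_bot] at h
    exact zero_ne_one h
  exact (Submodule.ne_bot_iff _).1 this

theorem reflEnd_eq (α β : V) : reflEnd β α = α - cpair α β • β := by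
  simp only [reflEnd, cpair, LinearMap.sub_apply, LinearMap.id_apply, LinearMap.comp_apply,
    LinearMap.toSpanSingleton_apply, LinearMap.smul_apply]
  congr 2
  simp [real_inner_comm]
  ring

theorem helper_neg (D : RootSystemData V) {α : V} (hα : α ∈ D.roots) : -α ∈ D.roots := by
  have h := D.reflect_mem α hα α hα
  have h0 : ⟪α, α⟫ ≠ 0 := inner_self_ne_zero.2 (D.ne_zero α hα)
  have : cpair α α = 2 := by rw [cpair]; field_simp
  rw [reflEnd_eq, this] at h
  convert h using 1
  module

theorem helper_caseA (D : LieRootData V L) (hG2 : D.toRootSystemData.NotG2)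
    {α β : V} (hα : α ∈ D.roots) (hβ : β ∈ D.roots)
    (h1 : cpair α β = -1) (h2 : cpair β α = -1)
    (h4 : ∀ a ∈ D.rs α, ∀ b ∈ D.rs β, (LieAlgebra.ad ℂ L (a + b)) ^ 4 = 0) : False := by
  have hα0 : ⟪α, α⟫ ≠ 0 := inner_self_ne_zero.2 (D.ne_zero α hα)
  have hβ0 : ⟪β, β⟫ ≠ 0 := inner_self_ne_zero.2 (D.ne_zero β hβ)
  have caa : cpair α α = 2 := by rw [cpair]; field_simp
  have cbb : cpair β β = 2 := by rw [cpair]; field_simp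
  have cadd : ∀ x y z : V, cpair (x + y) z = cpair x z + cpair y z := by
    intro x y z; simp only [cpair, inner_add_left]; ring
  have cneg : ∀ x z : V, cpair (-x) z = -cpair x z := by
    intro x z; simp only [cpair, inner_neg_left]; ring
  have c0 : ∀ z : V, cpair 0 z = 0 := by intro z; simp [cpair]
  have hθ : α + β ∈ D.roots := by
    have h := D.reflect_mem α hα β hβ
    rw [reflEnd_eq, h1] at h
    convert h using 1
    module
  have hnα := helper_neg D.toRootSystemData hα
  have hnβ := helper_neg D.toRootSystemData hβ
  have hnθ := helper_neg D.toRootSystemData hθ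
  obtain ⟨a, ha, ha0⟩ := helper_exists D hα
  obtain ⟨b, hb, hb0⟩ := helper_exists D hβ
  obtain ⟨f, hf, hf0⟩ := helper_exists D hnθ
  have e1 : α + -(α + β) = -β := by abel
  have e2 : β + -(α + β) = -α := by abel
  have e3 : -β + (α + β) = α := by abel
  have hp : ⁅a, f⁆ ∈ D.rs (-β) := by
    have := D.bracket_mem α hα _ hnθ (by rw [e1]; exact hnβ) a ha f hf
    rwa [e1] at this
  have hq : ⁅b, f⁆ ∈ D.rs (-α) := by
    have := D.bracket_mem β hβ _ hnθ (by rw [e2]; exact hnα) b hb f hf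
    rwa [e2] at this
  have hp0 : ⁅a, f⁆ ≠ 0 :=
    D.bracket_ne_zero α hα _ hnθ (by rw [e1]; exact hnβ) a ha ha0 f hf hf0
  have hc := D.bracket_mem α hα β hβ hθ a ha b hb
  have hc0 := D.bracket_ne_zero α hα β hβ hθ a ha ha0 b hb hb0
  have hH := D.bracket_cartan_mem β hβ b hb _ hp
  have hK := D.bracket_cartan_mem α hα a ha _ hq
  obtain ⟨A₁, h1a⟩ := D.weight_vec α hα _ hH a ha
  obtain ⟨B₁, h1b⟩ := D.weight_vec β hβ _ hH b hb
  obtain ⟨A₂, h2a⟩ := D.weight_vec α hα _ hK a ha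
  obtain ⟨B₂, h2b⟩ := D.weight_vec β hβ _ hK b hb
  have key : ∀ γ δ : V, (cpair (γ + δ) α = 3 ∨ cpair (γ + δ) β = 3) →
      γ + δ ∉ D.roots ∧ γ + δ ≠ 0 := by
    intro γ δ h
    constructor
    · intro hm
      rcases h with h | h
      · exact (hG2 _ hm _ hα).1 h
      · exact (hG2 _ hm _ hβ).1 h
    · intro hm
      rw [hm, c0, c0] at h
      norm_num at h
  refine helper_A2 a b f A₁ B₁ A₂ B₂ ?_ ?_ ha0 hb0 hc0 ?_ ?_ h1a h1b h2a h2b ?_ (h4 a ha b hb)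
  · obtain ⟨k1, k2⟩ := key α (-β) (Or.inl (by rw [cadd, cneg, caa, h2]; norm_num))
    exact D.bracket_eq_zero _ hα _ hnβ k1 k2 a ha _ hp
  · obtain ⟨k1, k2⟩ := key β (-α) (Or.inr (by rw [cadd, cneg, cbb, h1]; norm_num))
    exact D.bracket_eq_zero _ hβ _ hnα k1 k2 b hb _ hq
  · obtain ⟨k1, k2⟩ := key α (α + β) (Or.inl (by rw [cadd, cadd, caa, h2]; norm_num))
    exact D.bracket_eq_zero _ hα _ hθ k1 k2 a ha _ hc
  · obtain ⟨k1, k2⟩ := key β (α + β) (Or.inr (by rw [cadd, cadd, cbb, h1]; norm_num))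
    exact D.bracket_eq_zero _ hβ _ hθ k1 k2 b hb _ hc
  · exact D.bracket_ne_zero _ hnβ _ hθ (by rw [e3]; exact hα) _ hp hp0 _ hc hc0

theorem helper_caseB (D : LieRootData V L)
    {α β : V} (hα : α ∈ D.roots) (hβ : β ∈ D.roots)
    (h1 : cpair α β = -1) (h2 : cpair β α = -2)
    (h4 : ∀ a ∈ D.rs α, ∀ b ∈ D.rs β, (LieAlgebra.ad ℂ L (a + b)) ^ 4 = 0) : False := by
  have hα0 : ⟪α, α⟫ ≠ 0 := inner_self_ne_zero.2 (D.ne_zero α hα)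
  have hβ0 : ⟪β, β⟫ ≠ 0 := inner_self_ne_zero.2 (D.ne_zero β hβ)
  have iab : ⟪α, β⟫ = -⟪α, α⟫ := by
    have h := h2
    rw [cpair, div_eq_iff hα0, real_inner_comm] at h
    linarith
  have ibb : ⟪β, β⟫ = 2 * ⟪α, α⟫ := by
    have h := h1
    rw [cpair, div_eq_iff hβ0, iab] at h
    linarith
  have iba : ⟪β, α⟫ = -⟪α, α⟫ := by rw [real_inner_comm, iab]
  have hθ : α + β ∈ D.roots := by
    have h := D.reflect_mem α hα β hβ
    rw [reflEnd_eq, h1] at h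
    convert h using 1
    module
  have hη : α + (α + β) ∈ D.roots := by
    have h := D.reflect_mem β hβ α hα
    rw [reflEnd_eq, h2] at h
    convert h using 1
    module
  have hnα := helper_neg D.toRootSystemData hα
  obtain ⟨a, ha, ha0⟩ := helper_exists D hα
  obtain ⟨b, hb, hb0⟩ := helper_exists D hβ
  obtain ⟨f, hf, hf0⟩ := helper_exists D hnα
  have e3 : -α + (α + β) = β := by abel
  have hu := D.bracket_mem α hα β hβ hθ a ha b hb
  have hu0 := D.bracket_ne_zero α hα β hβ hθ a ha ha0 b hb hb0
  have hw := D.bracket_mem α hα _ hθ hη a ha _ hu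
  have hw0 := D.bracket_ne_zero α hα _ hθ hη a ha ha0 _ hu hu0
  have hH := D.bracket_cartan_mem α hα a ha _ hf
  obtain ⟨A, hA⟩ := D.weight_vec α hα _ hH a ha
  obtain ⟨B, hB⟩ := D.weight_vec β hβ _ hH b hb
  have key : ∀ (γ δ : V) (k : ℤ), k ≠ 0 → (-5 < k ∧ k < 5) →
      2 * ⟪α, γ + δ⟫ = k * ⟪α, α⟫ → ⟪γ + δ, γ + δ⟫ = 5 * ⟪α, α⟫ →
      γ + δ ∉ D.roots ∧ γ + δ ≠ 0 := by
    intro γ δ k hk hk5 hi hn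
    constructor
    · intro hm
      obtain ⟨n, hcn⟩ := D.crystallographic α hα _ hm
      rw [cpair, hi, hn, div_eq_iff (by simpa using hα0)] at hcn
      have : (k : ℝ) = 5 * n := by
        apply mul_right_cancel₀ hα0
        linarith
      have : k = 5 * n := by exact_mod_cast this
      omega
    · intro hm
      rw [hm, inner_zero_left] at hn
      exact hα0 (by linarith)
  refine helper_B2 a b f A B ?_ hw0 ?_ ?_ hA hB ?_ (h4 a ha b hb)
  · obtain ⟨k1, k2⟩ := key β (-α) (-4) (by norm_num) (by norm_num)
      (by simp only [inner_add_right, inner_neg_right, iab]; push_cast; ring)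
      (by simp only [inner_add_right, inner_neg_right, inner_add_left, inner_neg_left,
            iab, iba, ibb]; ring)
    exact D.bracket_eq_zero _ hβ _ hnα k1 k2 b hb _ hf
  · obtain ⟨k1, k2⟩ := key α (α + (α + β)) 4 (by norm_num) (by norm_num)
      (by simp only [inner_add_right, iab]; push_cast; ring)
      (by simp only [inner_add_right, inner_add_left, iab, iba, ibb]; ring)
    exact D.bracket_eq_zero _ hα _ hη k1 k2 a ha _ hw
  · obtain ⟨k1, k2⟩ := key β (α + β) (-2) (by norm_num) (by norm_num)
      (by simp only [inner_add_right, iab]; push_cast; ring)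
      (by simp only [inner_add_right, inner_add_left, iab, iba, ibb]; ring)
    exact D.bracket_eq_zero _ hβ _ hθ k1 k2 b hb _ hu
  · exact D.bracket_ne_zero _ hnα _ hθ (by rw [e3]; exact hβ) _ hf hf0 _ hu hu0

end Helpers

/-- Suppose `Φ` is irreducible and not of type `G₂`. If
`Ψ ⊆ Φ⁺` is any subset such that `𝔞_Ψ = ⊕_{α ∈ Ψ} 𝔤_α` is a spherical subspace
of `𝔫`, then `⟨α, β⟩ ≥ 0` for all `α, β ∈ Ψ`. -/
theorem pairing_nonneg_of_spherical
    {V : Type*} [NormedAddCommGroup V] [InnerProductSpace ℝ V]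
    {L : Type*} [LieRing L] [LieAlgebra ℂ L]
    (D : LieRootData V L)
    (hirr : D.toRootSystemData.IsIrreducible)
    (hG2 : D.toRootSystemData.NotG2)
    (Ψ : Set V) (hΨ : Ψ ⊆ D.pos)
    (hsph : IsSphericalSubspace (D.aSubspace Ψ)) :
    ∀ α ∈ Ψ, ∀ β ∈ Ψ, 0 ≤ cpair α β := by
  intro α hαΨ β hβΨ
  by_contra! hneg
  have hα := D.pos_subset (hΨ hαΨ)
  have hβ := D.pos_subset (hΨ hβΨ)
  have h4 : ∀ a ∈ D.rs α, ∀ b ∈ D.rs β, (LieAlgebra.ad ℂ L (a + b)) ^ 4 = 0 := by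
    intro a ha b hb
    apply hsph
    have hle : ∀ γ ∈ Ψ, D.rs γ ≤ D.aSubspace Ψ := fun γ hγ =>
      le_iSup₂_of_le (f := fun γ (_ : γ ∈ Ψ) => D.rs γ) γ hγ le_rfl
    exact add_mem (hle α hαΨ ha) (hle β hβΨ hb)
  have h4' : ∀ b ∈ D.rs β, ∀ a ∈ D.rs α, (LieAlgebra.ad ℂ L (b + a)) ^ 4 = 0 := by
    intro b hb a ha
    rw [add_comm]; exact h4 a ha b hb
  have hα0 : 0 < ⟪α, α⟫ := real_inner_self_pos.2 (D.ne_zero α hα)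
  have hβ0 : 0 < ⟪β, β⟫ := real_inner_self_pos.2 (D.ne_zero β hβ)
  have hab : ⟪α, β⟫ < 0 := by
    by_contra! h
    exact absurd hneg (not_lt.2 (by unfold cpair; positivity))
  have hcs : ⟪α, β⟫ * ⟪α, β⟫ < ⟪α, α⟫ * ⟪β, β⟫ := by
    -- strictness: expand the norm of a combination which is nonzero
    have hv : ⟪α, α⟫ • β - ⟪α, β⟫ • α ≠ 0 := by
      intro h
      have hβe : β = (⟪α, β⟫ / ⟪α, α⟫) • α := by
        have h' := sub_eq_zero.1 h
        rw [div_eq_inv_mul, mul_smul, ← h', smul_smul, inv_mul_cancel₀ hα0.ne', one_smul]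
      have hm : (⟪α, β⟫ / ⟪α, α⟫) • α ∈ D.roots := hβe ▸ hβ
      rcases D.reduced α hα _ hm with h1 | h1
      · have := div_neg_of_neg_of_pos hab hα0
        linarith
      · rw [h1, neg_one_smul] at hβe
        exact (D.pos_iff α hα).1 (hΨ hαΨ) (hβe ▸ hΨ hβΨ)
    have := real_inner_self_pos.2 hv
    simp only [inner_sub_left, inner_sub_right, real_inner_smul_left, real_inner_smul_right,
      real_inner_comm α β] at this
    have h' : 0 < ⟪α, α⟫ * (⟪α, α⟫ * ⟪β, β⟫ - ⟪α, β⟫ * ⟪α, β⟫) := by linarith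
    have := pos_of_mul_pos_right h' hα0.le
    linarith
  obtain ⟨m, hm⟩ := D.crystallographic α hα β hβ
  obtain ⟨n, hn⟩ := D.crystallographic β hβ α hα
  have hm0 : m < 0 := by rw [hm] at hneg; exact_mod_cast hneg
  have hn0 : n < 0 := by
    have : cpair β α < 0 := by
      unfold cpair
      rw [real_inner_comm]
      exact div_neg_of_neg_of_pos (by linarith) hα0
    rw [hn] at this; exact_mod_cast this
  have hmn : m * n < 4 := by
    have : cpair α β * cpair β α < 4 := by
      unfold cpair
      rw [real_inner_comm α β, div_mul_div_comm, div_lt_iff₀ (by positivity)]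
      nlinarith
    rw [hm, hn] at this; exact_mod_cast this
  have hm3 : m ≠ -3 := by
    rintro rfl; exact (hG2 α hα β hβ).2 (by rw [hm]; norm_num)
  have hn3 : n ≠ -3 := by
    rintro rfl; exact (hG2 β hβ α hα).2 (by rw [hn]; norm_num)
  have hm4 : -4 < m := by nlinarith
  have hn4 : -4 < n := by nlinarith
  have hcases : (m = -1 ∧ n = -1) ∨ (m = -1 ∧ n = -2) ∨ (m = -2 ∧ n = -1) := by
    interval_cases m <;> interval_cases n <;> simp_all
  rcases hcases with ⟨rfl, rfl⟩ | ⟨rfl, rfl⟩ | ⟨rfl, rfl⟩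
  · exact helper_caseA D hG2 hα hβ (by rw [hm]; norm_num) (by rw [hn]; norm_num) h4
  · exact helper_caseB D hα hβ (by rw [hm]; norm_num) (by rw [hn]; norm_num) h4
  · exact helper_caseB D hβ hα (by rw [hn]; norm_num) (by rw [hm]; norm_num) h4'
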